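/- Let ν_0 be a probability measure on ℕ with weights p_i = ν_0(i), and let ρ_d be the density on Δ_d of the projection μ ↦ (μ(1),…,μ(d)) of the Dirichlet(1/2, θ, ν_0) process. Then ρ_d integrates to 1 over Δ_d. -/

import Mathlib

open MeasureTheory Set

/-- The standard `d`-simplex in `ℝ^d`. -/
def simplexDelta (d : ℕ) : Set (Fin d → ℝ) :=
  {x | (∀ i, 0 ≤ x i) ∧ ∑ i, x i ≤ 1}

/-- Extend `x ∈ Δ_d` by the last barycentric coordinate `x_{d+1} = 1 - Σ x_i`. -/
noncomputable def extCoord {d : ℕ} (x : Fin d → ℝ) : Fin (d + 1) → ℝ :=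
  Fin.snoc x (1 - ∑ i, x i)

/-- The density on `Δ_d` of the projection of the `Dirichlet(1/2, θ, ν₀)` process,
with weights `p : Fin (d+1) → ℝ`. -/
noncomputable def rhoD (d : ℕ) (θ : ℝ) (p : Fin (d + 1) → ℝ) (x : Fin d → ℝ) : ℝ :=
  ((∏ j, p j) * Real.Gamma (θ + ((d : ℝ) + 1) / 2) /
      (Real.pi ^ ((d : ℝ) / 2) * Real.Gamma (θ + 1 / 2))) *
    (∏ j, extCoord x j ^ (-(3 : ℝ) / 2)) /
    (∑ j, (p j) ^ 2 / extCoord x j) ^ (θ + ((d : ℝ) + 1) / 2)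


open Filter Topology

lemma aux_y_deriv (a b s u : ℝ) (hu : 0 < u) (hus : u < s) :
    HasDerivAt (fun u : ℝ => (a * (s - u) - b * u) / √(s * u * (s - u)))
      (-(s ^ 2 * (a * (s - u) + b * u) / (2 * √(s * u * (s - u)) ^ 3))) u := by
  have hs : 0 < s := hu.trans hus
  have hsu : 0 < s - u := sub_pos.2 hus
  have hw : 0 < s * u * (s - u) := by positivity
  have hW : 0 < √(s * u * (s - u)) := Real.sqrt_pos.2 hw
  have hW2 : √(s * u * (s - u)) ^ 2 = s * u * (s - u) := Real.sq_sqrt hw.le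
  have h1 : HasDerivAt (fun u : ℝ => a * (s - u) - b * u) (-(a + b)) u := by
    have := (((hasDerivAt_id u).const_sub s).const_mul a).sub ((hasDerivAt_id u).const_mul b)
    refine this.congr_deriv ?_
    ring
  have h2 : HasDerivAt (fun u : ℝ => s * u * (s - u)) (s * (s - 2 * u)) u := by
    have := ((hasDerivAt_id u).const_mul s).mul ((hasDerivAt_id u).const_sub s)
    refine this.congr_deriv ?_
    simp
    ring
  have h3 := h1.div (h2.sqrt hw.ne') hW.ne'
  refine h3.congr_deriv ?_
  set W := √(s * u * (s - u))
  field_simp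
  rw [hW2]
  ring

lemma aux_tend_W (s : ℝ) (x : ℝ) (l : Filter ℝ) (hl : l ≤ 𝓝 x) (hx : s * x * (s - x) = 0)
    (hpos : ∀ᶠ u in l, 0 < s * u * (s - u)) :
    Tendsto (fun u : ℝ => (√(s * u * (s - u)))⁻¹) l atTop := by
  refine tendsto_inv_nhdsGT_zero.comp (tendsto_nhdsWithin_iff.2 ⟨?_, ?_⟩)
  · have : Continuous (fun u : ℝ => √(s * u * (s - u))) := by fun_prop
    have h := this.tendsto x
    rw [hx, Real.sqrt_zero] at h
    exact h.mono_left hl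
  · filter_upwards [hpos] with u hu using Real.sqrt_pos.2 hu

lemma aux_pos0 (s : ℝ) (hs : 0 < s) : ∀ᶠ u in 𝓝[>] (0:ℝ), 0 < s * u * (s - u) := by
  filter_upwards [Ioo_mem_nhdsGT hs] with u hu
  have := sub_pos.2 hu.2
  have := hu.1
  positivity

lemma aux_poss (s : ℝ) (hs : 0 < s) : ∀ᶠ u in 𝓝[<] s, 0 < s * u * (s - u) := by
  filter_upwards [Ioo_mem_nhdsLT hs] with u hu
  have := sub_pos.2 hu.2
  have := hu.1
  positivity

lemma aux_tend_num (a b s x : ℝ) (l : Filter ℝ) (hl : l ≤ 𝓝 x) :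
    Tendsto (fun u : ℝ => a * (s - u) - b * u) l (𝓝 (a * (s - x) - b * x)) := by
  have : Continuous (fun u : ℝ => a * (s - u) - b * u) := by fun_prop
  exact (this.tendsto x).mono_left hl

lemma aux_y0 (a b s : ℝ) (ha : 0 < a) (hs : 0 < s) :
    Tendsto (fun u : ℝ => (a * (s - u) - b * u) / √(s * u * (s - u))) (𝓝[>] 0) atTop := by
  simp only [div_eq_mul_inv]
  exact (aux_tend_num a b s 0 _ nhdsWithin_le_nhds).pos_mul_atTop (by simp; positivity)
    (aux_tend_W s 0 _ nhdsWithin_le_nhds (by simp) (aux_pos0 s hs))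

lemma aux_ys_neg (a b s : ℝ) (hb : b < 0) (hs : 0 < s) :
    Tendsto (fun u : ℝ => (a * (s - u) - b * u) / √(s * u * (s - u))) (𝓝[<] s) atTop := by
  simp only [div_eq_mul_inv]
  exact (aux_tend_num a b s s _ nhdsWithin_le_nhds).pos_mul_atTop (by simp; nlinarith)
    (aux_tend_W s s _ nhdsWithin_le_nhds (by simp) (aux_poss s hs))

lemma aux_ys_pos (a b s : ℝ) (hb : 0 < b) (hs : 0 < s) :
    Tendsto (fun u : ℝ => (a * (s - u) - b * u) / √(s * u * (s - u))) (𝓝[<] s) atBot := by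
  simp only [div_eq_mul_inv]
  exact (aux_tend_num a b s s _ nhdsWithin_le_nhds).neg_mul_atTop (by simp; positivity)
    (aux_tend_W s s _ nhdsWithin_le_nhds (by simp) (aux_poss s hs))

/-- Gaussian primitive. -/
noncomputable def auxPhi (y : ℝ) : ℝ := ∫ t in (0:ℝ)..y, Real.exp (-(1 / 2) * t ^ 2)

lemma auxPhi_deriv (y : ℝ) : HasDerivAt auxPhi (Real.exp (-(1 / 2) * y ^ 2)) y := by
  have hc : Continuous (fun t : ℝ => Real.exp (-(1 / 2) * t ^ 2)) := by fun_prop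
  exact intervalIntegral.integral_hasDerivAt_right (hc.intervalIntegrable _ _)
    (hc.stronglyMeasurableAtFilter _ _) hc.continuousAt

lemma auxPhi_top : Tendsto auxPhi atTop (𝓝 (√(2 * Real.pi) / 2)) := by
  have h := intervalIntegral_tendsto_integral_Ioi (f := fun t : ℝ => Real.exp (-(1 / 2) * t ^ 2))
    (μ := volume) 0 (integrable_exp_neg_mul_sq (b := 1/2) (by norm_num)).integrableOn
    (tendsto_id (α := ℝ) (x := atTop))
  rw [integral_gaussian_Ioi] at h
  convert h using 3
  congr 1; ring

lemma auxPhi_neg (y : ℝ) : auxPhi (-y) = - auxPhi y := by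
  unfold auxPhi
  have := intervalIntegral.integral_comp_neg (a := 0) (b := y)
    (fun t : ℝ => Real.exp (-(1 / 2) * t ^ 2))
  simp only [neg_zero, even_two, Even.neg_pow] at this
  rw [this, intervalIntegral.integral_symm]

lemma auxPhi_bot : Tendsto auxPhi atBot (𝓝 (-(√(2 * Real.pi) / 2))) := by
  have := (auxPhi_top.comp tendsto_neg_atBot_atTop).neg
  refine this.congr fun y => ?_
  simp [auxPhi_neg]

/-- FTC on an open interval, nonnegative derivative. -/
lemma aux_ftc {G g : ℝ → ℝ} {a b A B : ℝ} (hab : a < b)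
    (hd : ∀ x ∈ Ioo a b, HasDerivAt G (g x) x) (hpos : ∀ x ∈ Ioo a b, 0 ≤ g x)
    (hA : Tendsto G (𝓝[>] a) (𝓝 A)) (hB : Tendsto G (𝓝[<] b) (𝓝 B)) :
    ∫⁻ x in Ioo a b, ENNReal.ofReal (g x) = ENNReal.ofReal (B - A) := by
  have hc : ContinuousOn G (Ioo a b) := fun x hx => (hd x hx).continuousAt.continuousWithinAt
  have hcont := continuousOn_Icc_extendFrom_Ioo hc hA hB
  have hint : IntegrableOn g (Ioc a b) := by
    refine intervalIntegral.integrableOn_deriv_of_nonneg hcont (fun x hx => ?_) hpos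
    refine (hd x hx).congr_of_eventuallyEq ?_
    filter_upwards [Ioo_mem_nhds hx.1 hx.2] with y hy
    exact extendFrom_eq (subset_closure hy) (hc y hy)
  have h := intervalIntegral.integral_eq_sub_of_hasDerivAt_of_tendsto hab hd
    ((intervalIntegrable_iff_integrableOn_Ioc_of_le hab.le).2 hint) hA hB
  rw [intervalIntegral.integral_of_le hab.le, integral_Ioc_eq_integral_Ioo] at h
  rw [← h, ofReal_integral_eq_lintegral_ofReal (hint.mono_set Ioo_subset_Ioc_self)]
  exact (ae_restrict_iff' measurableSet_Ioo).2 (ae_of_all _ hpos)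

lemma aux_conv_core (a b s : ℝ) (ha : 0 < a) (hb : 0 < b) (hs : 0 < s) :
    ∫⁻ u in Ioo 0 s, ENNReal.ofReal (a * b * s ^ 3 / √(s * u * (s - u)) ^ 3 *
      Real.exp (-(1 / 2) * ((a * (s - u) - b * u) / √(s * u * (s - u))) ^ 2)) =
      ENNReal.ofReal ((a + b) * √(2 * Real.pi)) := by
  set y := fun u : ℝ => (a * (s - u) - b * u) / √(s * u * (s - u)) with hy
  set z := fun u : ℝ => (a * (s - u) - (-b) * u) / √(s * u * (s - u)) with hz
  set E := Real.exp (2 * a * b / s) with hE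
  have key := aux_ftc (G := fun u => -(a + b) * auxPhi (y u) - (b - a) * E * auxPhi (z u))
    (g := fun u => a * b * s ^ 3 / √(s * u * (s - u)) ^ 3 * Real.exp (-(1 / 2) * (y u) ^ 2))
    (A := -(a + b) * (√(2 * Real.pi) / 2) - (b - a) * E * (√(2 * Real.pi) / 2))
    (B := -(a + b) * (-(√(2 * Real.pi) / 2)) - (b - a) * E * (√(2 * Real.pi) / 2))
    hs ?_ ?_ ?_ ?_
  · rw [key]; congr 1; ring
  · rintro u ⟨hu, hus⟩
    have hsu : 0 < s - u := sub_pos.2 hus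
    have hw : 0 < s * u * (s - u) := by positivity
    have hW : 0 < √(s * u * (s - u)) := Real.sqrt_pos.2 hw
    have hW2 : √(s * u * (s - u)) ^ 2 = s * u * (s - u) := Real.sq_sqrt hw.le
    have dy := (auxPhi_deriv (y u)).comp u (aux_y_deriv a b s u hu hus)
    have dz := (auxPhi_deriv (z u)).comp u (aux_y_deriv a (-b) s u hu hus)
    refine ((dy.const_mul (-(a + b))).sub (dz.const_mul ((b - a) * E))).congr_deriv ?_
    have hez : E * Real.exp (-(1 / 2) * (z u) ^ 2) = Real.exp (-(1 / 2) * (y u) ^ 2) := by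
      rw [hE, ← Real.exp_add]
      congr 1
      simp only [hy, hz, div_pow, hW2]
      field_simp
      ring
    rw [mul_assoc (b - a) E, ← mul_assoc E, hez]
    set W := √(s * u * (s - u))
    field_simp
    ring
  · rintro u ⟨hu, hus⟩
    positivity
  · exact ((auxPhi_top.comp (aux_y0 a b s ha hs)).const_mul _).sub
      ((auxPhi_top.comp (aux_y0 a (-b) s ha hs)).const_mul _)
  · exact ((auxPhi_bot.comp (aux_ys_pos a b s hb hs)).const_mul _).sub
      ((auxPhi_top.comp (aux_ys_neg a (-b) s (by linarith) hs)).const_mul _)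

/-- Density of the one-sided stable law of index one half. -/
noncomputable def stab (p s : ℝ) : ℝ :=
  if 0 < s then p / √(2 * Real.pi) * s ^ (-(3:ℝ) / 2) * Real.exp (-(p ^ 2 / (2 * s))) else 0

lemma stab_of_pos (p : ℝ) {s : ℝ} (hs : 0 < s) : stab p s =
    p / √(2 * Real.pi) * s ^ (-(3:ℝ) / 2) * Real.exp (-(p ^ 2 / (2 * s))) := if_pos hs

lemma stab_of_nonpos (p : ℝ) {s : ℝ} (hs : s ≤ 0) : stab p s = 0 := if_neg hs.not_gt

lemma stab_nonneg {p : ℝ} (hp : 0 < p) (s : ℝ) : 0 ≤ stab p s := by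
  unfold stab
  split_ifs with h
  · positivity
  · exact le_rfl

lemma stab_measurable (p : ℝ) : Measurable (stab p) := by
  unfold stab
  exact Measurable.ite measurableSet_Ioi (by fun_prop) measurable_const

lemma aux_rpow (s : ℝ) (hs : 0 < s) : s ^ (-(3:ℝ) / 2) = (√s ^ 3)⁻¹ := by
  rw [Real.sqrt_eq_rpow, ← Real.rpow_natCast, ← Real.rpow_mul hs.le, ← Real.rpow_neg hs.le]
  norm_num

lemma stab_conv (a b s : ℝ) (ha : 0 < a) (hb : 0 < b) :
    ∫⁻ u, ENNReal.ofReal (stab a u) * ENNReal.ofReal (stab b (s - u)) =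
      ENNReal.ofReal (stab (a + b) s) := by
  rcases le_or_gt s 0 with hs | hs
  · rw [stab_of_nonpos _ hs]
    have : ∀ u, ENNReal.ofReal (stab a u) * ENNReal.ofReal (stab b (s - u)) = 0 := by
      intro u
      rcases le_or_gt u 0 with hu | hu
      · simp [stab_of_nonpos a hu]
      · simp [stab_of_nonpos b (by linarith : s - u ≤ 0)]
    simp [this]
  set K := Real.exp (-((a + b) ^ 2 / (2 * s))) * (√s ^ 3)⁻¹ / (2 * Real.pi) with hK
  have hK0 : 0 ≤ K := by positivity
  have h1 : ∀ u, ENNReal.ofReal (stab a u) * ENNReal.ofReal (stab b (s - u)) =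
      (Ioo 0 s).indicator (fun u => ENNReal.ofReal K *
      ENNReal.ofReal (a * b * s ^ 3 / √(s * u * (s - u)) ^ 3 *
      Real.exp (-(1 / 2) * ((a * (s - u) - b * u) / √(s * u * (s - u))) ^ 2))) u := by
    intro u
    by_cases hu : u ∈ Ioo 0 s
    · rw [indicator_of_mem hu, ← ENNReal.ofReal_mul hK0, ← ENNReal.ofReal_mul (stab_nonneg ha _)]
      obtain ⟨hu, hus⟩ := hu
      have hsu : 0 < s - u := sub_pos.2 hus
      congr 1
      rw [stab_of_pos _ hu, stab_of_pos _ hsu, aux_rpow _ hu, aux_rpow _ hsu]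
      have hw : 0 < s * u * (s - u) := by positivity
      have hW2 : √(s * u * (s - u)) ^ 2 = s * u * (s - u) := Real.sq_sqrt hw.le
      have hW : √(s * u * (s - u)) = √s * √u * √(s - u) := by
        rw [Real.sqrt_mul (by positivity), Real.sqrt_mul hs.le]
      have he : Real.exp (-(a ^ 2 / (2 * u))) * Real.exp (-(b ^ 2 / (2 * (s - u)))) =
          Real.exp (-((a + b) ^ 2 / (2 * s))) *
          Real.exp (-(1 / 2) * ((a * (s - u) - b * u) / √(s * u * (s - u))) ^ 2) := by
        rw [← Real.exp_add, ← Real.exp_add]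
        congr 1
        rw [div_pow, hW2]
        field_simp
        ring
      have h2pi : √(2 * Real.pi) ^ 2 = 2 * Real.pi := Real.sq_sqrt (by positivity)
      have hss : √s ^ 2 = s := Real.sq_sqrt hs.le
      have hs6 : s ^ 3 = √s ^ 6 := by
        calc s ^ 3 = (√s ^ 2) ^ 3 := by rw [hss]
          _ = √s ^ 6 := by ring
      trans (a * b / √(2 * Real.pi) ^ 2 * (√u ^ 3)⁻¹ * (√(s - u) ^ 3)⁻¹) *
        (Real.exp (-(a ^ 2 / (2 * u))) * Real.exp (-(b ^ 2 / (2 * (s - u)))))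
      · ring
      rw [he, h2pi, hK]
      generalize Real.exp (-(1 / 2) * ((a * (s - u) - b * u) / √(s * u * (s - u))) ^ 2) = X
      rw [hW, hs6]
      have : 0 < √s := Real.sqrt_pos.2 hs
      have : 0 < √u := Real.sqrt_pos.2 hu
      have : 0 < √(s - u) := Real.sqrt_pos.2 hsu
      field_simp
    · rw [indicator_of_notMem hu]
      rcases le_or_gt u 0 with hu0 | hu0
      · simp [stab_of_nonpos a hu0]
      · have : s ≤ u := by
          by_contra h
          exact hu ⟨hu0, not_le.1 h⟩
        simp [stab_of_nonpos b (by linarith : s - u ≤ 0)]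
  simp_rw [h1]
  rw [lintegral_indicator measurableSet_Ioo, lintegral_const_mul' _ _ ENNReal.ofReal_ne_top,
    aux_conv_core a b s ha hb hs, ← ENNReal.ofReal_mul hK0, stab_of_pos _ hs, aux_rpow _ hs, hK]
  congr 1
  have h2pi : √(2 * Real.pi) ^ 2 = 2 * Real.pi := Real.sq_sqrt (by positivity)
  have hT : 0 < √(2 * Real.pi) := by positivity
  rw [← Real.sq_sqrt (by positivity : 0 ≤ 2 * Real.pi)]
  rw [h2pi]
  generalize √(2 * Real.pi) = T at *
  rw [← h2pi]
  field_simp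

lemma stab_multi_conv (d : ℕ) : ∀ (p : Fin (d + 1) → ℝ), (∀ j, 0 < p j) → ∀ s : ℝ,
    ∫⁻ x : Fin d → ℝ, (∏ i : Fin d, ENNReal.ofReal (stab (p i.castSucc) (x i))) *
      ENNReal.ofReal (stab (p (Fin.last d)) (s - ∑ i, x i)) =
      ENNReal.ofReal (stab (∑ j, p j) s) := by
  induction d with
  | zero =>
    intro p hp s
    simp [volume_pi, Measure.pi_univ]
  | succ d ih =>
    intro p hp s
    have hm : ∀ q, Measurable fun x => ENNReal.ofReal (stab q x) :=
      fun q => (stab_measurable q).ennreal_ofReal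
    rw [← (volume_preserving_piFinSuccAbove (fun _ : Fin (d + 1) => ℝ) 0).symm.lintegral_comp_emb
      (MeasurableEquiv.measurableEmbedding _)]
    have h1 : ∀ a : ℝ × (Fin d → ℝ),
        (∏ i : Fin (d + 1), ENNReal.ofReal (stab (p i.castSucc)
          ((MeasurableEquiv.piFinSuccAbove (fun _ : Fin (d + 1) => ℝ) 0).symm a i))) *
        ENNReal.ofReal (stab (p (Fin.last (d + 1))) (s - ∑ i,
          (MeasurableEquiv.piFinSuccAbove (fun _ : Fin (d + 1) => ℝ) 0).symm a i)) =
        ENNReal.ofReal (stab (p 0) a.1) *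
        ((∏ i : Fin d, ENNReal.ofReal (stab (p i.castSucc.succ) (a.2 i))) *
        ENNReal.ofReal (stab (p (Fin.last d).succ) (s - a.1 - ∑ i, a.2 i))) := by
      intro a
      simp [MeasurableEquiv.piFinSuccAbove, Fin.prod_univ_succ, Fin.sum_univ_succ,
        Fin.insertNthEquiv, mul_assoc, sub_sub]
    simp_rw [h1]
    rw [Measure.volume_eq_prod, lintegral_prod]
    · simp only
      have h2 : ∀ x : ℝ, ∫⁻ y : Fin d → ℝ, ENNReal.ofReal (stab (p 0) x) *
          ((∏ i : Fin d, ENNReal.ofReal (stab (p i.castSucc.succ) (y i))) *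
          ENNReal.ofReal (stab (p (Fin.last d).succ) (s - x - ∑ i, y i))) =
          ENNReal.ofReal (stab (p 0) x) *
          ENNReal.ofReal (stab (∑ j : Fin (d + 1), p j.succ) (s - x)) := by
        intro x
        rw [lintegral_const_mul' _ _ ENNReal.ofReal_ne_top,
          ih (fun j => p j.succ) (fun j => hp _) (s - x)]
      simp_rw [h2]
      rw [stab_conv _ _ _ (hp 0) (Finset.sum_pos (fun j _ => hp _) Finset.univ_nonempty),
        Fin.sum_univ_succ (f := p)]
    · refine Measurable.aemeasurable ?_
      refine ((hm _).comp measurable_fst).mul (Measurable.mul ?_ ?_)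
      · refine Finset.measurable_prod _ fun i _ => (hm _).comp ?_
        fun_prop
      · refine (hm _).comp ?_
        fun_prop

lemma aux_inv_gamma (σ c : ℝ) (hσ : 0 < σ) (hc : 0 < c) :
    ∫⁻ r in Ioi (0:ℝ), ENNReal.ofReal (r ^ (-σ - 1) * Real.exp (-(c / r))) =
      ENNReal.ofReal (c ^ (-σ) * Real.Gamma σ) := by
  have h := Real.integral_rpow_mul_exp_neg_mul_Ioi hσ hc
  have hne : (1 / c) ^ σ * Real.Gamma σ ≠ 0 :=
    (mul_pos (by positivity) (Real.Gamma_pos_of_pos hσ)).ne'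
  rw [← integral_comp_rpow_Ioi _ (by norm_num : (-1:ℝ) ≠ 0)] at h
  have h2 : ∀ r ∈ Ioi (0:ℝ), (|(-1:ℝ)| * r ^ ((-1:ℝ) - 1)) •
      ((r ^ (-1:ℝ)) ^ (σ - 1) * Real.exp (-(c * r ^ (-1:ℝ)))) =
      r ^ (-σ - 1) * Real.exp (-(c / r)) := by
    intro r hr
    have hr : 0 < r := hr
    rw [← Real.rpow_mul hr.le, smul_eq_mul, ← mul_assoc, abs_neg, abs_one, one_mul,
      ← Real.rpow_add hr, Real.rpow_neg_one, div_eq_mul_inv]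
    congr 2
    ring
  rw [setIntegral_congr_fun measurableSet_Ioi h2] at h
  rw [← ofReal_integral_eq_lintegral_ofReal, h]
  · rw [one_div, Real.inv_rpow hc.le, Real.rpow_neg hc.le]
  · exact Integrable.of_integral_ne_zero (by rw [h]; exact hne)
  · refine (ae_restrict_iff' measurableSet_Ioi).2 (ae_of_all _ fun r hr => ?_)
    have hr : 0 < r := hr
    simp only [Pi.zero_apply]
    positivity

lemma aux_scale (d : ℕ) (g : (Fin d → ℝ) → ENNReal) (hg : Measurable g) (r : ℝ) (hr : 0 < r) :
    ENNReal.ofReal (r ^ d) * ∫⁻ x, g (r • x) = ∫⁻ x, g x := by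
  have h := Measure.map_addHaar_smul (volume : Measure (Fin d → ℝ)) hr.ne'
  have h1 : ∫⁻ x, g (r • x) = ∫⁻ x, g x ∂(Measure.map (r • ·) volume) :=
    (lintegral_map hg (by fun_prop)).symm
  rw [h1, h, lintegral_smul_measure, smul_eq_mul, ← mul_assoc, ← ENNReal.ofReal_mul (by positivity),
    Module.finrank_fin_fun, abs_of_pos (by positivity), mul_inv_cancel₀ (by positivity)]
  simp

/-- The normalising constant. -/
noncomputable def auxC (θ : ℝ) : ℝ :=
  (√(2 * Real.pi))⁻¹ * ((1 / 2 : ℝ) ^ (-(θ + 1 / 2)) * Real.Gamma (θ + 1 / 2))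

lemma auxC_pos (θ : ℝ) (hθ : -1 / 2 < θ) : 0 < auxC θ := by
  unfold auxC
  have := Real.Gamma_pos_of_pos (by linarith : 0 < θ + 1 / 2)
  positivity

lemma aux_total (θ : ℝ) (hθ : -1 / 2 < θ) :
    ∫⁻ r in Ioi (0:ℝ), ENNReal.ofReal (r ^ (-θ)) * ENNReal.ofReal (stab 1 r) =
      ENNReal.ofReal (auxC θ) := by
  have h : ∀ r ∈ Ioi (0:ℝ), ENNReal.ofReal (r ^ (-θ)) * ENNReal.ofReal (stab 1 r) =
      ENNReal.ofReal ((√(2 * Real.pi))⁻¹) *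
      ENNReal.ofReal (r ^ (-(θ + 1 / 2) - 1) * Real.exp (-((1 / 2) / r))) := by
    intro r hr
    have hr : 0 < r := hr
    rw [← ENNReal.ofReal_mul (by positivity), ← ENNReal.ofReal_mul (by positivity),
      stab_of_pos _ hr, show -(θ + 1 / 2) - 1 = -θ + -(3:ℝ) / 2 by ring, Real.rpow_add hr]
    congr 1
    rw [show (1:ℝ) ^ 2 / (2 * r) = 1 / 2 / r by field_simp]
    ring
  rw [setLIntegral_congr_fun measurableSet_Ioi h, lintegral_const_mul' _ _ ENNReal.ofReal_ne_top,
    aux_inv_gamma _ _ (by linarith) (by norm_num), ← ENNReal.ofReal_mul (by positivity)]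
  rfl

lemma extCoord_prod (d : ℕ) (p : Fin (d + 1) → ℝ) (x : Fin d → ℝ) (r : ℝ) :
    (∏ i : Fin d, ENNReal.ofReal (stab (p i.castSucc) ((r • x) i))) *
      ENNReal.ofReal (stab (p (Fin.last d)) (r - ∑ i, (r • x) i)) =
    ∏ j, ENNReal.ofReal (stab (p j) (r * extCoord x j)) := by
  rw [Fin.prod_univ_castSucc]
  simp [extCoord, mul_sub, Finset.mul_sum]

lemma aux_prod_real (d : ℕ) (θ : ℝ) (p : Fin (d + 1) → ℝ) (X : Fin (d + 1) → ℝ)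
    (hX : ∀ j, 0 < X j) (r : ℝ) (hr : 0 < r) :
    r ^ (-θ) * (r ^ d * ∏ j, stab (p j) (r * X j)) =
    ((∏ j, p j) * (√(2 * Real.pi) ^ (d + 1))⁻¹ * ∏ j, X j ^ (-(3 : ℝ) / 2)) *
      (r ^ (-(θ + ((d : ℝ) + 1) / 2) - 1) * Real.exp (-((∑ j, p j ^ 2 / X j) / 2 / r))) := by
  have h1 : ∀ j, stab (p j) (r * X j) = p j * (√(2 * Real.pi))⁻¹ * r ^ (-(3 : ℝ) / 2) *
      X j ^ (-(3 : ℝ) / 2) * Real.exp (-(p j ^ 2 / X j / 2 / r)) := by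
    intro j
    have := hX j
    rw [stab_of_pos _ (by positivity), Real.mul_rpow hr.le this.le,
      show p j ^ 2 / (2 * (r * X j)) = p j ^ 2 / X j / 2 / r by field_simp]
    ring
  simp_rw [h1, Finset.prod_mul_distrib, ← Real.exp_sum, Finset.prod_const, Finset.card_univ,
    Fintype.card_fin, Finset.sum_neg_distrib, ← Finset.sum_div]
  have h2 : r ^ (-(θ + ((d : ℝ) + 1) / 2) - 1) =
      r ^ (-θ) * r ^ d * (r ^ (-(3 : ℝ) / 2)) ^ (d + 1) := by
    rw [← Real.rpow_natCast r d, ← Real.rpow_natCast _ (d + 1), ← Real.rpow_mul hr.le,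
      ← Real.rpow_add hr, ← Real.rpow_add hr]
    congr 1
    push_cast
    ring
  rw [h2, inv_pow]
  ring

lemma aux_const (d : ℕ) (θ : ℝ) (hθ : -1 / 2 < θ) (p : Fin (d + 1) → ℝ) (x : Fin d → ℝ)
    (hA : 0 < ∑ j, p j ^ 2 / extCoord x j) :
    ((∏ j, p j) * (√(2 * Real.pi) ^ (d + 1))⁻¹ * ∏ j, extCoord x j ^ (-(3 : ℝ) / 2)) *
      (((∑ j, p j ^ 2 / extCoord x j) / 2) ^ (-(θ + ((d : ℝ) + 1) / 2)) *
        Real.Gamma (θ + ((d : ℝ) + 1) / 2)) = auxC θ * rhoD d θ p x := by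
  unfold auxC rhoD
  have hG := Real.Gamma_pos_of_pos (by linarith : 0 < θ + 1 / 2)
  generalize ∑ j, p j ^ 2 / extCoord x j = A at *
  generalize ∏ j, extCoord x j ^ (-(3 : ℝ) / 2) = Y
  generalize ∏ j, p j = P
  have hAs : 0 < A ^ (θ + ((d : ℝ) + 1) / 2) := by positivity
  have e1 : (A / 2) ^ (-(θ + ((d : ℝ) + 1) / 2)) =
      (A ^ (θ + ((d : ℝ) + 1) / 2))⁻¹ * (2 ^ (θ + 1 / 2) * 2 ^ ((d : ℝ) / 2)) := by
    rw [← Real.rpow_add two_pos, Real.rpow_neg (by positivity), Real.div_rpow hA.le two_pos.le,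
      inv_div, show θ + 1 / 2 + (d : ℝ) / 2 = θ + ((d : ℝ) + 1) / 2 by ring]
    ring
  have e2 : (1 / 2 : ℝ) ^ (-(θ + 1 / 2)) = 2 ^ (θ + 1 / 2) := by
    rw [one_div, Real.inv_rpow two_pos.le, Real.rpow_neg two_pos.le, inv_inv]
  have e3 : √(2 * Real.pi) ^ (d + 1) =
      2 ^ ((d : ℝ) / 2) * Real.pi ^ ((d : ℝ) / 2) * √(2 * Real.pi) := by
    rw [pow_succ, ← Real.mul_rpow two_pos.le Real.pi_pos.le, Real.sqrt_eq_rpow,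
      ← Real.rpow_natCast, ← Real.rpow_mul (by positivity)]
    congr 2
    ring
  rw [e1, e2, e3]
  have hT : 0 < √(2 * Real.pi) := by positivity
  have hpi : 0 < Real.pi ^ ((d : ℝ) / 2) := by positivity
  have h2 : (0:ℝ) < 2 ^ ((d : ℝ) / 2) := by positivity
  generalize √(2 * Real.pi) = T at *
  generalize Real.pi ^ ((d : ℝ) / 2) = Q at *
  generalize (2:ℝ) ^ ((d : ℝ) / 2) = R at *
  generalize A ^ (θ + ((d : ℝ) + 1) / 2) = S at *
  generalize Real.Gamma (θ + 1 / 2) = G at *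
  field_simp

lemma aux_pointwise (d : ℕ) (θ : ℝ) (hθ : -1 / 2 < θ)
    (p : Fin (d + 1) → ℝ) (hp : ∀ j, 0 < p j) (x : Fin d → ℝ) :
    ∫⁻ r in Ioi (0:ℝ), ENNReal.ofReal (r ^ (-θ)) * (ENNReal.ofReal (r ^ d) *
      ∏ j, ENNReal.ofReal (stab (p j) (r * extCoord x j))) =
    (simplexDelta d).indicator
      (fun x => ENNReal.ofReal (auxC θ) * ENNReal.ofReal (rhoD d θ p x)) x := by
  by_cases hX : ∀ j, 0 < extCoord x j
  · have hx : x ∈ simplexDelta d := by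
      constructor
      · intro i
        have := hX i.castSucc
        simp only [extCoord, Fin.snoc_castSucc] at this
        exact this.le
      · have := hX (Fin.last d)
        simp only [extCoord, Fin.snoc_last] at this
        linarith
    have hA : 0 < ∑ j, p j ^ 2 / extCoord x j :=
      Finset.sum_pos (fun j _ => div_pos (pow_pos (hp j) 2) (hX j)) Finset.univ_nonempty
    have hK : 0 ≤ (∏ j, p j) * (√(2 * Real.pi) ^ (d + 1))⁻¹ *
        ∏ j, extCoord x j ^ (-(3 : ℝ) / 2) := by
      have h1 : 0 < ∏ j, p j := Finset.prod_pos fun j _ => hp j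
      have h2 : 0 < ∏ j, extCoord x j ^ (-(3 : ℝ) / 2) :=
        Finset.prod_pos fun j _ => Real.rpow_pos_of_pos (hX j) _
      positivity
    have h : ∀ r ∈ Ioi (0:ℝ), ENNReal.ofReal (r ^ (-θ)) * (ENNReal.ofReal (r ^ d) *
        ∏ j, ENNReal.ofReal (stab (p j) (r * extCoord x j))) =
        ENNReal.ofReal ((∏ j, p j) * (√(2 * Real.pi) ^ (d + 1))⁻¹ *
          ∏ j, extCoord x j ^ (-(3 : ℝ) / 2)) *
        ENNReal.ofReal (r ^ (-(θ + ((d : ℝ) + 1) / 2) - 1) *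
          Real.exp (-((∑ j, p j ^ 2 / extCoord x j) / 2 / r))) := by
      intro r hr
      have hr : 0 < r := hr
      rw [← ENNReal.ofReal_mul hK, ← aux_prod_real d θ p _ hX r hr,
        ENNReal.ofReal_mul (by positivity), ENNReal.ofReal_mul (by positivity),
        ENNReal.ofReal_prod_of_nonneg (fun j _ => stab_nonneg (hp j) _)]
    rw [setLIntegral_congr_fun measurableSet_Ioi h,
      lintegral_const_mul' _ _ ENNReal.ofReal_ne_top,
      aux_inv_gamma _ _ (by have : (0:ℝ) ≤ d := Nat.cast_nonneg d; linarith) (by positivity),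
      ← ENNReal.ofReal_mul hK, aux_const d θ hθ p x hA, indicator_of_mem hx,
      ENNReal.ofReal_mul (auxC_pos θ hθ).le]
  · push Not at hX
    obtain ⟨j, hj⟩ := hX
    have hL : ∀ r ∈ Ioi (0:ℝ), ENNReal.ofReal (r ^ (-θ)) * (ENNReal.ofReal (r ^ d) *
        ∏ j, ENNReal.ofReal (stab (p j) (r * extCoord x j))) = 0 := by
      intro r hr
      have hr : 0 < r := hr
      rw [Finset.prod_eq_zero (Finset.mem_univ j), mul_zero, mul_zero]
      rw [stab_of_nonpos _ (mul_nonpos_of_nonneg_of_nonpos hr.le hj), ENNReal.ofReal_zero]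
    rw [setLIntegral_congr_fun measurableSet_Ioi hL, lintegral_zero]
    symm
    by_cases hx : x ∈ simplexDelta d
    · rw [indicator_of_mem hx]
      have h0 : extCoord x j = 0 := by
        refine le_antisymm hj ?_
        refine Fin.lastCases ?_ (fun i => ?_) j
        · simpa [extCoord] using hx.2
        · simpa [extCoord] using hx.1 i
      have : rhoD d θ p x = 0 := by
        unfold rhoD
        rw [Finset.prod_eq_zero (f := fun j => extCoord x j ^ (-(3 : ℝ) / 2)) (Finset.mem_univ j)]
        · simp
        · rw [h0, Real.zero_rpow (by norm_num)]
      simp [this]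
    · exact indicator_of_notMem hx _

lemma extCoord_measurable (d : ℕ) (j : Fin (d + 1)) :
    Measurable fun x : Fin d → ℝ => extCoord x j := by
  unfold extCoord
  refine Fin.lastCases ?_ (fun i => ?_) j
  · simp only [Fin.snoc_last]; fun_prop
  · simp only [Fin.snoc_castSucc]; fun_prop

lemma simplexDelta_measurable (d : ℕ) : MeasurableSet (simplexDelta d) := by
  have : simplexDelta d = (⋂ i, {x : Fin d → ℝ | 0 ≤ x i}) ∩ {x | ∑ i, x i ≤ 1} := by
    ext x; simp [simplexDelta]
  rw [this]
  refine (MeasurableSet.iInter fun i => measurableSet_le measurable_const (by fun_prop)).inter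
    (measurableSet_le (by fun_prop) measurable_const)

lemma rhoD_measurable (d : ℕ) (θ : ℝ) (p : Fin (d + 1) → ℝ) : Measurable (rhoD d θ p) := by
  unfold rhoD
  have h := extCoord_measurable d
  refine Measurable.div (Measurable.mul measurable_const ?_) (Measurable.pow_const ?_ _)
  · exact Finset.measurable_prod _ fun j _ => (h j).pow_const _
  · exact Finset.measurable_sum _ fun j _ => measurable_const.div (h j)

lemma rhoD_nonneg (d : ℕ) (θ : ℝ) (hθ : -1 / 2 < θ) (p : Fin (d + 1) → ℝ) (hp : ∀ j, 0 < p j)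
    (x : Fin d → ℝ) (hx : x ∈ simplexDelta d) : 0 ≤ rhoD d θ p x := by
  have h0 : ∀ j, 0 ≤ extCoord x j := by
    intro j
    refine Fin.lastCases ?_ (fun i => ?_) j
    · simpa [extCoord] using hx.2
    · simpa [extCoord] using hx.1 i
  unfold rhoD
  have h1 := Real.Gamma_pos_of_pos (by linarith : 0 < θ + 1 / 2)
  have h2 := Real.Gamma_pos_of_pos
    (by have : (0:ℝ) ≤ d := Nat.cast_nonneg d; linarith : 0 < θ + ((d : ℝ) + 1) / 2)
  have h3 : 0 < ∏ j, p j := Finset.prod_pos fun j _ => hp j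
  have h4 : 0 ≤ ∏ j, extCoord x j ^ (-(3 : ℝ) / 2) :=
    Finset.prod_nonneg fun j _ => Real.rpow_nonneg (h0 j) _
  have h5 : 0 ≤ ∑ j, p j ^ 2 / extCoord x j :=
    Finset.sum_nonneg fun j _ => div_nonneg (sq_nonneg _) (h0 j)
  positivity

lemma rhoD_lintegral (d : ℕ) (θ : ℝ) (hθ : -1 / 2 < θ)
    (p : Fin (d + 1) → ℝ) (hp : ∀ j, 0 < p j) (hsum : ∑ j, p j = 1) :
    ∫⁻ x in simplexDelta d, ENNReal.ofReal (rhoD d θ p x) = 1 := by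
  have hm : ∀ q, Measurable fun x => ENNReal.ofReal (stab q x) :=
    fun q => (stab_measurable q).ennreal_ofReal
  have key : ENNReal.ofReal (auxC θ) * ∫⁻ x in simplexDelta d, ENNReal.ofReal (rhoD d θ p x) =
      ENNReal.ofReal (auxC θ) := by
    rw [← lintegral_const_mul' _ _ ENNReal.ofReal_ne_top,
      ← lintegral_indicator (simplexDelta_measurable d)]
    simp_rw [← aux_pointwise d θ hθ p hp]
    rw [lintegral_lintegral_swap]
    · rw [← aux_total θ hθ]
      refine setLIntegral_congr_fun measurableSet_Ioi fun r hr => ?_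
      have hr : 0 < r := hr
      rw [lintegral_const_mul' _ _ ENNReal.ofReal_ne_top,
        lintegral_const_mul' _ _ ENNReal.ofReal_ne_top]
      simp_rw [← extCoord_prod]
      rw [aux_scale d (fun y => (∏ i : Fin d, ENNReal.ofReal (stab (p i.castSucc) (y i))) *
        ENNReal.ofReal (stab (p (Fin.last d)) (r - ∑ i, y i))) ?_ r hr,
        stab_multi_conv d p hp r, hsum]
      refine Measurable.mul ?_ ?_
      · refine Finset.measurable_prod _ fun i _ => (hm _).comp ?_
        fun_prop
      · refine (hm _).comp ?_
        fun_prop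
    · refine Measurable.aemeasurable ?_
      refine Measurable.mul (by fun_prop) (Measurable.mul (by fun_prop) ?_)
      refine Finset.measurable_prod _ fun j _ => (hm _).comp ?_
      exact measurable_snd.mul ((extCoord_measurable d j).comp measurable_fst)
  have hC : ENNReal.ofReal (auxC θ) ≠ 0 := (ENNReal.ofReal_pos.2 (auxC_pos θ hθ)).ne'
  exact (ENNReal.mul_right_inj hC ENNReal.ofReal_ne_top).1 (by rw [key, mul_one])

/-- The density `ρ_d` of the projection `μ ↦ (μ(1),…,μ(d))` of the
`Dirichlet(1/2, θ, ν₀)` process integrates to `1` over `Δ_d`. -/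
theorem rhoD_integrates_to_one (d : ℕ) (hd : 1 ≤ d) (θ : ℝ) (hθ : -1/2 < θ)
    (p : Fin (d + 1) → ℝ) (hp : ∀ j, 0 < p j) (hsum : ∑ j, p j = 1) :
    ∫ x in simplexDelta d, rhoD d θ p x = 1 := by
  rw [integral_eq_lintegral_of_nonneg_ae, rhoD_lintegral d θ hθ p hp hsum]
  · simp
  · exact (ae_restrict_iff' (simplexDelta_measurable d)).2
      (ae_of_all _ fun x hx => rhoD_nonneg d θ hθ p hp x hx)
  · exact (rhoD_measurable d θ p).aestronglyMeasurable
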